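/- arXiv:1308.5014 — 2 statements merged into one kernel-verified Lean document; each statement's English description precedes it below -/
import Mathlib

section
/- Let V be a finite set and let E ⊆ V × V be an acyclic adjacency relation encoding an acyclic amplified graph with finitely many vertices, let S be the set of sources, and let H be the associated submonoid of the free abelian group ⊕_{v∈V} ℤ. If n = (n_v)_{v∈V} ∈ H satisfies n_v ≥ 1 for every v ∈ S, then there exists m = (m_v)_{v∈V} ∈ H with m_v ≥ 1 for every v ∈ V, and there exists a group automorphism α of ⊕_{v∈V} ℤ such that α(H) = H and α(n) = m. -/
/-- The positive cone of `K₀` of the amplified graph with adjacency relation `E`. -/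
def amplifiedCone {V : Type} [Fintype V] [DecidableEq V] (E : V → V → Prop) :
    AddSubmonoid (V → ℤ) :=
  AddSubmonoid.closure
    ({x | ∃ v : V, x = Pi.single v (1 : ℤ)} ∪
     {x | ∃ (v : V) (k : V → ℕ), (∃ w, E v w) ∧ (∀ w, 0 < k w → E v w) ∧
        x = Pi.single v (1 : ℤ) - ∑ w : V, (k w : ℤ) • Pi.single w (1 : ℤ)})

/-- The transvection of `V → ℤ` sending `δ_v` to `δ_v + c • δ_w` and fixing the other basis
elements. -/
def shear {V : Type} [DecidableEq V] {v w : V} (hvw : v ≠ w) (c : ℤ) :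
    (V → ℤ) ≃+ (V → ℤ) where
  toFun x := x + Pi.single w (c * x v)
  invFun x := x + Pi.single w (-c * x v)
  left_inv x := by
    simp [hvw, add_assoc, ← Pi.single_add]
  right_inv x := by
    simp [hvw, add_assoc, ← Pi.single_add]
  map_add' x y := by
    simp only [Pi.add_apply, mul_add, Pi.single_add]
    abel

section Cone

variable {V : Type}

theorem shear_apply [DecidableEq V] {v w : V} (hvw : v ≠ w) (c : ℤ) (x : V → ℤ) :
    shear hvw c x = x + Pi.single w (c * x v) := rfl

variable [Fintype V] [DecidableEq V] {E : V → V → Prop}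

theorem sum_smul_single_one (z : V → ℤ) :
    ∑ w : V, z w • (Pi.single w (1 : ℤ) : V → ℤ) = z := by
  ext v
  simp [Finset.sum_apply, Pi.single_apply]

theorem single_one_mem_amplifiedCone (v : V) :
    (Pi.single v 1 : V → ℤ) ∈ amplifiedCone E :=
  AddSubmonoid.subset_closure (Or.inl ⟨v, rfl⟩)

theorem natCast_mem_amplifiedCone (k : V → ℕ) :
    (fun w => (k w : ℤ)) ∈ amplifiedCone E := by
  rw [← sum_smul_single_one fun w => (k w : ℤ)]
  refine AddSubmonoid.sum_mem _ fun w _ => ?_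
  rw [natCast_zsmul]
  exact AddSubmonoid.nsmul_mem _ (single_one_mem_amplifiedCone w) _

theorem single_one_sub_mem_amplifiedCone {v : V} (hv : ∃ w, E v w) {z : V → ℤ}
    (hz : ∀ w, 0 < z w → E v w) : Pi.single v 1 - z ∈ amplifiedCone E := by
  have hneg : Pi.single v 1 - (fun w => ((z w).toNat : ℤ)) ∈ amplifiedCone E := by
    refine AddSubmonoid.subset_closure (Or.inr ⟨v, fun w => (z w).toNat, hv, fun w hw => ?_, ?_⟩)
    · exact hz w (Int.lt_toNat.1 hw)
    · rw [sum_smul_single_one fun w => ((z w).toNat : ℤ)]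
  convert AddSubmonoid.add_mem _ hneg (natCast_mem_amplifiedCone fun w => (-z w).toNat) using 1
  ext w
  simp only [Pi.sub_apply, Pi.add_apply]
  omega

theorem shear_mem_amplifiedCone {v w : V} (hvw : v ≠ w) (hE : E v w) (hv : ¬ E v v) (c : ℤ)
    {x : V → ℤ} (hx : x ∈ amplifiedCone E) : shear hvw c x ∈ amplifiedCone E := by
  have hsub : ∀ d : ℤ, Pi.single v 1 - Pi.single w d ∈ amplifiedCone E := fun d =>
    single_one_sub_mem_amplifiedCone ⟨w, hE⟩ fun a ha => by
      obtain rfl : a = w := by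
        by_contra h
        simp [h] at ha
      exact hE
  suffices h : amplifiedCone E ≤ (amplifiedCone E).comap (shear hvw c).toAddMonoidHom from h hx
  refine AddSubmonoid.closure_le.2 ?_
  rintro _ (⟨u, rfl⟩ | ⟨u, k, hu, hk, rfl⟩)
  · change shear hvw c _ ∈ amplifiedCone E
    rw [shear_apply]
    obtain rfl | huv := eq_or_ne u v
    · simpa [Pi.single_neg] using hsub (-c)
    · simpa [huv.symm] using single_one_mem_amplifiedCone u
  · change shear hvw c _ ∈ amplifiedCone E
    rw [sum_smul_single_one fun w => (k w : ℤ), shear_apply]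
    obtain rfl | huv := eq_or_ne u v
    · have hku : k u = 0 := by
        by_contra h
        exact hv (hk u (by omega))
      have hmem : Pi.single u 1 - ((fun w => (k w : ℤ)) - Pi.single w c) ∈ amplifiedCone E := by
        refine single_one_sub_mem_amplifiedCone hu fun a ha => ?_
        obtain rfl | haw := eq_or_ne a w
        · exact hE
        · exact hk a (by simpa [haw] using ha)
      convert hmem using 1
      simp [hku]
      abel
    · obtain hkv | hkv := Nat.eq_zero_or_pos (k v)
      · simpa [hkv, huv.symm] using single_one_sub_mem_amplifiedCone hu
          (z := fun w => (k w : ℤ)) fun a ha => hk a (by exact_mod_cast ha)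
      · have hmem : Pi.single u 1 - ((fun w => (k w : ℤ)) + Pi.single v 1) ∈ amplifiedCone E := by
          refine single_one_sub_mem_amplifiedCone hu fun a ha => ?_
          obtain rfl | hav := eq_or_ne a v
          · exact hk a hkv
          · exact hk a (by simpa [hav] using ha)
        convert AddSubmonoid.add_mem _ hmem (hsub (c * k v)) using 1
        simp [huv.symm, Pi.single_neg]
        abel

theorem image_shear_amplifiedCone {v w : V} (hvw : v ≠ w) (hE : E v w) (hv : ¬ E v v) (c : ℤ) :
    shear hvw c '' (amplifiedCone E : Set (V → ℤ)) = amplifiedCone E := by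
  refine Set.Subset.antisymm ?_ fun x hx => ?_
  · rintro _ ⟨x, hx, rfl⟩
    exact shear_mem_amplifiedCone hvw hE hv c hx
  · exact ⟨(shear hvw c).symm x, shear_mem_amplifiedCone hvw hE hv (-c) hx,
      (shear hvw c).apply_symm_apply x⟩

theorem exists_addEquiv_image_amplifiedCone_forall_one_le
    (hacyc : ∀ v : V, ¬ Relation.TransGen E v v) (n : V → ℤ)
    (hn : ∀ v : V, (∀ w, ¬ E w v) → 1 ≤ n v) :
    ∃ α : (V → ℤ) ≃+ (V → ℤ),
      α '' (amplifiedCone E : Set (V → ℤ)) = amplifiedCone E ∧ ∀ v, 1 ≤ α n v := by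
  by_cases hpos : ∀ v, 1 ≤ n v
  · exact ⟨AddEquiv.refl _, by simp, hpos⟩
  push Not at hpos
  have : Std.Irrefl (Relation.TransGen E) := ⟨hacyc⟩
  obtain ⟨w, hw, hmin⟩ :=
    (Finite.wellFounded_of_trans_of_irrefl (Relation.TransGen E)).has_min {v | n v < 1} hpos
  rw [Set.mem_ofPred_eq] at hw
  obtain ⟨v, hE⟩ : ∃ v, E v w := by
    by_contra! h
    exact absurd (hn w h) (by omega)
  have hvw : v ≠ w := by
    rintro rfl
    exact hacyc v (.single hE)
  have hnv : 1 ≤ n v := not_lt.1 fun h => hmin v h (.single hE)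
  have hnw : 1 ≤ shear hvw (1 - n w) n w := by
    simp only [shear_apply, Pi.add_apply, Pi.single_eq_same]
    nlinarith
  have hne : ∀ a, a ≠ w → shear hvw (1 - n w) n a = n a := fun a ha => by
    simp [shear_apply, ha]
  have hlt : (Finset.univ.filter fun a => shear hvw (1 - n w) n a < 1).card <
      (Finset.univ.filter fun a => n a < 1).card := by
    refine Finset.card_lt_card (Finset.ssubset_iff_of_subset ?_ |>.2 ⟨w, ?_, ?_⟩)
    · intro a ha
      obtain rfl | haw := eq_or_ne a w
      · simpa using hw
      · simpa [hne a haw] using ha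
    · simpa using hw
    · simpa using hnw
  obtain ⟨α, hα, hαn⟩ := exists_addEquiv_image_amplifiedCone_forall_one_le hacyc
    (shear hvw (1 - n w) n) fun a ha => by
      rw [hne a fun h => ha v (h ▸ hE)]
      exact hn a ha
  refine ⟨(shear hvw (1 - n w)).trans α, ?_, hαn⟩
  rw [AddEquiv.coe_trans, Set.image_comp,
    image_shear_amplifiedCone hvw hE (fun h => hacyc v (.single h)), hα]
termination_by (Finset.univ.filter fun a => n a < 1).card

end Cone

/-!
STATEMENT 0 (Lemma 3.3 of the paper).  `V` is a finite vertex set and `E ⊆ V × V` an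
acyclic adjacency relation encoding an acyclic amplified graph (whenever `E v w` holds there
are countably infinitely many parallel edges from `v` to `w`).  `H` is the submonoid of
`⊕_{v ∈ V} ℤ = (V → ℤ)` generated by the standard basis elements `δ_v` together with all
elements `δ_v - ∑_w k(w) • δ_w` where `v` has at least one out-neighbour and `k : V → ℕ`
is supported on the out-neighbours of `v`.  If `n ∈ H` has `n v ≥ 1` for every source `v`,
then there is `m ∈ H` with `m v ≥ 1` for every `v ∈ V` and an automorphism `α` of `V → ℤ`
with `α (H) = H` and `α n = m`.
-/
theorem stmt_0 {V : Type} [Fintype V] [DecidableEq V] (E : V → V → Prop)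
    (hacyc : ∀ v : V, ¬ Relation.TransGen E v v)
    (H : AddSubmonoid (V → ℤ))
    (hH : H = AddSubmonoid.closure
      ({x | ∃ v : V, x = Pi.single v (1 : ℤ)} ∪
       {x | ∃ (v : V) (k : V → ℕ), (∃ w, E v w) ∧ (∀ w, 0 < k w → E v w) ∧
          x = Pi.single v (1 : ℤ) - ∑ w : V, (k w : ℤ) • Pi.single w (1 : ℤ)}))
    (n : V → ℤ) (hn : n ∈ H)
    (hnS : ∀ v : V, (∀ w, ¬ E w v) → 1 ≤ n v) :
    ∃ m : V → ℤ, m ∈ H ∧ (∀ v : V, 1 ≤ m v) ∧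
      ∃ α : (V → ℤ) ≃+ (V → ℤ),
        (⇑α '' (H : Set (V → ℤ)) = (H : Set (V → ℤ))) ∧ α n = m := by
  obtain ⟨α, hα, hαn⟩ := exists_addEquiv_image_amplifiedCone_forall_one_le hacyc n hnS
  have hαH : α '' (H : Set (V → ℤ)) = (H : Set (V → ℤ)) := by
    rw [hH]
    exact hα
  exact ⟨α n, hαH.subset ⟨n, hn, rfl⟩, hαn, α, hαH, rfl⟩
end

section
/- Let (E, d) be a Bratteli diagram with levels W_n. Suppose v ∈ W_n and k ≤ n. If w ∈ E⁰ is a vertex with v ≥ w and d(w) = Σ_{α ∈ W_k E* w} d(s(α)), then d(v) = Σ_{α ∈ W_k E* v} d(s(α)). -/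
/-- Paths in a directed graph with vertex set `V`, edge set `E`, source map `s` and
range map `r`.  `DPath s r u v` is the type of paths from `u` to `v`; the length-zero
path at `v` is `DPath.nil v`. -/
inductive DPath {V E : Type} (s r : E → V) : V → V → Type
  | nil (v : V) : DPath s r v v
  | cons {w : V} (e : E) (p : DPath s r (r e) w) : DPath s r (s e) w

/-- A Bratteli diagram: a directed graph with no sinks whose vertex set is partitioned
into finite levels `W_n = {v | level v = n}` (for `n ≥ 1`) such that every edge goes
from some level `n` to level `n + 1`, together with a degree function `d` taking
positive values and satisfying `d v ≥ ∑_{e ∈ E¹v} d (s e)` for every vertex `v`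
(the sum being over the, necessarily finitely many, edges with range `v`). -/
structure BratteliDiagram where
  V : Type
  E : Type
  s : E → V
  r : E → V
  level : V → ℕ
  d : V → ℕ
  level_pos : ∀ v, 1 ≤ level v
  level_finite : ∀ n, {v | level v = n}.Finite
  edge_level : ∀ e, level (r e) = level (s e) + 1
  no_sinks : ∀ v, ∃ e, s e = v
  d_pos : ∀ v, 0 < d v
  edges_to_finite : ∀ v, {e | r e = v}.Finite
  d_ge : ∀ v, ∑ᶠ e ∈ {e | r e = v}, d (s e) ≤ d v

/-- `∑_{α ∈ W_k E* v} d (s α)`: the sum of `d` over the sources of all paths with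
range `v` and source in level `k` (the length-zero path at `v` being included when
`level v = k`). -/
noncomputable def levelPathSum (B : BratteliDiagram) (k : ℕ) (v : B.V) : ℕ :=
  ∑ᶠ p ∈ {p : (u : B.V) × DPath B.s B.r u v | B.level p.1 = k}, B.d p.1

namespace DPath

variable {V E : Type} {s r : E → V}

/-- The list of edges of a path. -/
def edges {u v : V} : DPath s r u v → List E
  | nil _ => []
  | cons e p => e :: p.edges

/-- Append an edge at the end of a path. -/
def snoc (e : E) {u x : V} : DPath s r u x → s e = x → DPath s r u (r e)
  | nil _, h => h ▸ cons e (nil (r e))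
  | cons f p, h => cons f (p.snoc e h)

theorem edges_snoc (e : E) {u x : V} (p : DPath s r u x) (h : s e = x) :
    (p.snoc e h).edges = p.edges ++ [e] := by
  induction p with
  | nil x => subst h; rfl
  | cons f p ih => simp [snoc, edges, ih h]

theorem sigma_ext {v : V} : ∀ {p q : (u : V) × DPath s r u v},
    p.2.edges = q.2.edges → p = q := by
  rintro ⟨u, p⟩ ⟨u', q⟩ h
  induction p generalizing u' with
  | nil x =>
    cases q with
    | nil => rfl
    | cons f q => simp [edges] at h
  | cons e p ih =>
    cases q with
    | nil => simp [edges] at h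
    | cons f q =>
      simp only [edges, List.cons.injEq] at h
      obtain ⟨rfl, h⟩ := h
      have := ih _ q h
      simp only [Sigma.mk.injEq, heq_eq_eq, true_and] at this
      rw [this]

/-- Append an edge with range `v` at the end of a path, keeping track of the source. -/
def snocSigma {v : V} (e : {e : E | r e = v}) (p : (u : V) × DPath s r u (s e)) :
    (u : V) × DPath s r u v :=
  ⟨p.1, cast (congrArg (DPath s r p.1) e.2) (p.2.snoc e.1 rfl)⟩

theorem edges_snocSigma {v : V} (e : {e : E | r e = v}) (p : (u : V) × DPath s r u (s e)) :
    (snocSigma e p).2.edges = p.2.edges ++ [e.1] := by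
  obtain ⟨e, rfl⟩ := e
  exact edges_snoc e p.2 rfl

theorem snocSigma_injective {v : V} (e : {e : E | r e = v}) :
    Function.Injective (snocSigma (s := s) e) := fun p q h => by
  have h' := congrArg (fun p => p.2.edges) h
  simp only [edges_snocSigma] at h'
  exact sigma_ext (List.append_cancel_right h')

theorem eq_nil_or_exists_snocSigma {u v : V} (p : DPath s r u v) :
    (⟨u, p⟩ : (u : V) × DPath s r u v) = ⟨v, nil v⟩ ∨
      ∃ (e : {e : E | r e = v}) (q : (u : V) × DPath s r u (s e)), snocSigma e q = ⟨u, p⟩ := by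
  induction p with
  | nil v => exact Or.inl rfl
  | cons f p ih =>
    right
    rcases ih with h | ⟨e, q, h⟩
    · have hv := congrArg Sigma.fst h
      refine ⟨⟨f, hv⟩, ⟨s f, nil _⟩, sigma_ext ?_⟩
      have := congrArg (fun p => p.2.edges) h
      simp only at this
      rw [edges_snocSigma]
      simp [edges, this]
    · obtain ⟨u', q⟩ := q
      have hu : u' = r f := congrArg Sigma.fst h
      subst hu
      refine ⟨e, ⟨s f, cons f q⟩, sigma_ext ?_⟩
      have := congrArg (fun p => p.2.edges) h
      simp only [edges_snocSigma] at this
      rw [edges_snocSigma]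
      simp [edges, ← this]

end DPath

namespace BratteliDiagram

variable (B : BratteliDiagram)

/-- The paths with range `v` and source in level `k`. -/
def levelPaths (k : ℕ) (v : B.V) : Set ((u : B.V) × DPath B.s B.r u v) :=
  {p | B.level p.1 = k}

theorem level_add_length {u v : B.V} (p : DPath B.s B.r u v) :
    B.level u + p.edges.length = B.level v := by
  induction p with
  | nil v => rfl
  | cons e p ih =>
    rw [← ih, B.edge_level, DPath.edges, List.length_cons]
    omega

theorem levelPaths_level (v : B.V) : B.levelPaths (B.level v) v = {⟨v, DPath.nil v⟩} := by
  ext p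
  refine ⟨fun h => DPath.sigma_ext ?_, by rintro rfl; rfl⟩
  have hp : B.level p.1 = B.level v := h
  have := B.level_add_length p.2
  exact List.length_eq_zero_iff.1 (by omega)

theorem levelPaths_eq_iUnion {k : ℕ} {v : B.V} (h : B.level v ≠ k) :
    B.levelPaths k v =
      ⋃ e : {e | B.r e = v}, DPath.snocSigma e '' B.levelPaths k (B.s e) := by
  ext ⟨u, p⟩
  simp only [Set.mem_iUnion, Set.mem_image]
  constructor
  · intro hp
    rcases p.eq_nil_or_exists_snocSigma with hn | ⟨e, q, hq⟩
    · rw [hn] at hp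
      exact absurd hp h
    · rw [← hq] at hp
      exact ⟨e, q, hp, hq⟩
  · rintro ⟨e, q, hq, he⟩
    rw [← he]
    exact hq

instance finite_edges_to (v : B.V) : Finite {e | B.r e = v} :=
  (B.edges_to_finite v).to_subtype

theorem level_eq_level_source_add_one {v : B.V} (e : {e | B.r e = v}) :
    B.level v = B.level (B.s e) + 1 := by
  obtain ⟨e, rfl⟩ := e
  exact B.edge_level e

theorem finite_levelPaths (k : ℕ) (v : B.V) : (B.levelPaths k v).Finite := by
  induction hn : B.level v using Nat.strong_induction_on generalizing v with
  | _ n ih =>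
    by_cases h : B.level v = k
    · rw [← h, levelPaths_level]
      exact Set.finite_singleton _
    · rw [B.levelPaths_eq_iUnion h]
      refine Set.finite_iUnion fun e => (ih _ ?_ _ rfl).image _
      have := B.level_eq_level_source_add_one e
      omega

theorem levelPathSum_level (v : B.V) : levelPathSum B (B.level v) v = B.d v := by
  change ∑ᶠ p ∈ B.levelPaths (B.level v) v, B.d p.1 = _
  rw [levelPaths_level, finsum_mem_singleton]

theorem levelPathSum_eq_finsum {k : ℕ} {v : B.V} (h : B.level v ≠ k) :
    levelPathSum B k v = ∑ᶠ e : {e | B.r e = v}, levelPathSum B k (B.s e) := by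
  change ∑ᶠ p ∈ B.levelPaths k v, B.d p.1 = _
  rw [B.levelPaths_eq_iUnion h, finsum_mem_iUnion]
  · exact finsum_congr fun e => finsum_mem_image (DPath.snocSigma_injective e).injOn
  · intro e f hef
    refine Set.disjoint_left.2 ?_
    rintro _ ⟨p, -, rfl⟩ ⟨q, -, hq⟩
    have := congrArg (fun p => p.2.edges) hq
    simp only [DPath.edges_snocSigma] at this
    exact hef (Subtype.ext (by simpa using (List.append_inj_right' this rfl).symm))
  · exact fun e => (B.finite_levelPaths k _).image _

theorem finsum_d_source_le (v : B.V) : ∑ᶠ e : {e | B.r e = v}, B.d (B.s e) ≤ B.d v :=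
  (finsum_set_coe_eq_finsum_mem {e | B.r e = v} (f := fun e => B.d (B.s e))).trans_le (B.d_ge v)

theorem levelPathSum_le (k : ℕ) (v : B.V) : levelPathSum B k v ≤ B.d v := by
  induction hn : B.level v using Nat.strong_induction_on generalizing v with
  | _ n ih =>
    by_cases h : B.level v = k
    · rw [← h, levelPathSum_level]
    · have := Fintype.ofFinite {e | B.r e = v}
      have hd := B.finsum_d_source_le v
      rw [finsum_eq_sum_of_fintype] at hd
      rw [B.levelPathSum_eq_finsum h, finsum_eq_sum_of_fintype]
      refine (Finset.sum_le_sum fun e _ => ih _ ?_ _ rfl).trans hd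
      have := B.level_eq_level_source_add_one e
      omega

theorem d_source_eq_levelPathSum {k : ℕ} (e : B.E) (hk : B.level (B.r e) ≠ k)
    (h : B.d (B.r e) = levelPathSum B k (B.r e)) :
    B.d (B.s e) = levelPathSum B k (B.s e) := by
  have := Fintype.ofFinite {f | B.r f = B.r e}
  have hd := B.finsum_d_source_le (B.r e)
  rw [h, B.levelPathSum_eq_finsum hk, finsum_eq_sum_of_fintype, finsum_eq_sum_of_fintype] at hd
  have hle : ∀ f ∈ (Finset.univ : Finset {f | B.r f = B.r e}),
      levelPathSum B k (B.s f) ≤ B.d (B.s f) := fun f _ => B.levelPathSum_le k _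
  exact ((Finset.sum_eq_sum_iff_of_le hle).1 ((Finset.sum_le_sum hle).antisymm hd)
    ⟨e, rfl⟩ (Finset.mem_univ _)).symm

end BratteliDiagram

/-!
STATEMENT 2 (first part of Lemma 4.2 of the paper).  Let `(E, d)` be a Bratteli diagram
with levels `W_n`, let `v ∈ W_n` and `k ≤ n`.  If `w` is a vertex with `v ≥ w` (there is
a path from `v` to `w`) and `d w = ∑_{α ∈ W_k E* w} d (s α)`, then
`d v = ∑_{α ∈ W_k E* v} d (s α)`.
-/
theorem stmt_2 (B : BratteliDiagram) (k : ℕ) (hk : 1 ≤ k) (v : B.V)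
    (hkv : k ≤ B.level v) (w : B.V)
    (hvw : Nonempty (DPath B.s B.r v w))
    (hw : B.d w = levelPathSum B k w) :
    B.d v = levelPathSum B k v := by
  obtain ⟨p⟩ := hvw
  induction p with
  | nil => exact hw
  | cons e p ih =>
    have := B.edge_level e
    exact B.d_source_eq_levelPathSum e (by omega) (ih (by omega) hw)
end
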